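/- (Wye-Delta transformation preserves terminal distances.) Let G be a k-terminal weighted graph with edge lengths ℓ, and let x ∉ K be a non-terminal whose only incident edges go to three pairwise non-adjacent vertices u, v, w. Let G' be obtained from G by deleting x (and its three incident edges) and adding edges {u,v}, {v,w}, {w,u} with lengths ℓ(u,x)+ℓ(v,x), ℓ(v,x)+ℓ(w,x), and ℓ(w,x)+ℓ(u,x), respectively. Then d_{G'}(a,b) = d_G(a,b) for all terminals a, b ∈ K. -/

import Mathlib

open scoped ENNReal

/-- A `k`-terminal weighted graph with edge lengths: a finite simple undirected graph
with nonnegative edge lengths `len` (with `len u v = 0` whenever `{u,v}` is not an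
edge). -/
structure WGraph (V : Type*) where
  verts : Finset V
  Adj : V → V → Prop
  symm : ∀ u v, Adj u v → Adj v u
  irrefl : ∀ v, ¬Adj v v
  adj_mem : ∀ u v, Adj u v → u ∈ verts ∧ v ∈ verts
  len : V → V → ℝ
  len_symm : ∀ u v, len u v = len v u
  len_nonneg : ∀ u v, 0 ≤ len u v

/-- `p` is a path from `s` to `t` in `G`, recorded as the list of its vertices. -/
def IsUPath {V : Type*} (G : WGraph V) (s t : V) (p : List V) : Prop :=
  p.Chain' G.Adj ∧ p.head? = some s ∧ p.getLast? = some t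

/-- The total length of a path recorded as a list of vertices: the sum of the lengths
of its consecutive edges. -/
noncomputable def pathLen {V : Type*} (G : WGraph V) (p : List V) : ℝ :=
  ((p.zip p.tail).map fun e => G.len e.1 e.2).sum

/-- The shortest-path distance between `u` and `v` in `G` (`+∞` if there is no path
from `u` to `v`). -/
noncomputable def graphDist {V : Type*} (G : WGraph V) (s t : V) : ℝ≥0∞ :=
  sInf {x | ∃ p : List V, IsUPath G s t p ∧ x = ENNReal.ofReal (pathLen G p)}

/-- `WD G t s r`: there is a walk from `s` to `t` of length `r`. -/
inductive WD {V : Type*} (G : WGraph V) (t : V) : V → ℝ → Prop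
  | nil : WD G t t 0
  | cons (s c : V) (r : ℝ) : G.Adj s c → WD G t c r → WD G t s (G.len s c + r)

theorem WD.exists_path {V : Type*} {G : WGraph V} {t s : V} {r : ℝ} (h : WD G t s r) :
    ∃ p, IsUPath G s t p ∧ pathLen G p = r := by
  induction h with
  | nil => exact ⟨[t], ⟨List.isChain_singleton _, rfl, rfl⟩, by simp [pathLen]⟩
  | cons s c r hadj _ ih =>
    obtain ⟨p, ⟨h1, h2, h3⟩, h4⟩ := ih
    cases p with
    | nil => simp at h2
    | cons d q =>
      simp only [List.head?_cons, Option.some.injEq] at h2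
      subst h2
      refine ⟨s :: d :: q, ⟨List.isChain_cons_cons.2 ⟨hadj, h1⟩, rfl, ?_⟩, ?_⟩
      · rw [List.getLast?_cons_cons]; exact h3
      · rw [← h4]; simp [pathLen]

theorem WD.of_path {V : Type*} {G : WGraph V} {t : V} (p : List V) :
    ∀ s, IsUPath G s t p → WD G t s (pathLen G p) := by
  induction p with
  | nil => rintro s ⟨_, h, _⟩; simp at h
  | cons c q ih =>
    rintro s ⟨h1, h2, h3⟩
    simp only [List.head?_cons, Option.some.injEq] at h2
    subst h2
    cases q with
    | nil =>
      simp only [List.getLast?_singleton, Option.some.injEq] at h3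
      subst h3
      have : pathLen G [c] = 0 := by simp [pathLen]
      rw [this]; exact WD.nil
    | cons d q =>
      have h1' := List.isChain_cons_cons.1 h1
      rw [List.getLast?_cons_cons] at h3
      have : pathLen G (c :: d :: q) = G.len c d + pathLen G (d :: q) := by simp [pathLen]
      rw [this]
      exact WD.cons _ _ _ h1'.1 (ih d ⟨h1'.2, rfl, h3⟩)

theorem graphDist_le_of_WD {V : Type*} {G G' : WGraph V} {s t : V}
    (h : ∀ r, WD G t s r → ∃ r', r' ≤ r ∧ WD G' t s r') :
    graphDist G' s t ≤ graphDist G s t := by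
  refine le_sInf ?_
  rintro y ⟨p, hp, rfl⟩
  obtain ⟨r', hr, hw⟩ := h _ (WD.of_path p s hp)
  obtain ⟨q, hq, rfl⟩ := hw.exists_path
  exact le_trans (sInf_le (by exact ⟨q, hq, rfl⟩)) (ENNReal.ofReal_le_ofReal hr)

theorem set_pair_eq {V : Type*} {a b c d : V} :
    ({a, b} : Set V) = {c, d} ↔ (a = c ∧ b = d) ∨ (a = d ∧ b = c) :=
  Set.pair_eq_pair_iff

/-- The Wye-Delta transformation preserves terminal distances: if `x ∉ K` is a
non-terminal whose only incident edges go to the three pairwise non-adjacent vertices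
`u, v, w`, and `G'` is obtained from `G` by deleting `x` (and its three incident
edges) and adding edges `{u,v}, {v,w}, {w,u}` with lengths `len u x + len v x`,
`len v x + len w x`, `len w x + len u x`, then `graphDist G' a b = graphDist G a b`
for all terminals `a, b ∈ K`. -/
theorem wye_delta_preserves_distances {V : Type*} [DecidableEq V]
    (G G' : WGraph V) (K : Finset V) (hK : K ⊆ G.verts)
    (x u v w : V) (hxK : x ∉ K)
    (huv : u ≠ v) (hvw : v ≠ w) (huw : u ≠ w)
    (huvAdj : ¬G.Adj u v) (hvwAdj : ¬G.Adj v w) (huwAdj : ¬G.Adj u w)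
    (hnb : ∀ a, G.Adj x a ↔ a = u ∨ a = v ∨ a = w)
    (hverts : G'.verts = G.verts.erase x)
    (hAdj : ∀ a b, G'.Adj a b ↔
      ((G.Adj a b ∧ a ≠ x ∧ b ≠ x) ∨ ({a, b} : Set V) = {u, v} ∨
        ({a, b} : Set V) = {v, w} ∨ ({a, b} : Set V) = {w, u}))
    (hluv : G'.len u v = G.len u x + G.len v x)
    (hlvw : G'.len v w = G.len v x + G.len w x)
    (hlwu : G'.len w u = G.len w x + G.len u x)
    (hlold : ∀ a b, a ≠ x → b ≠ x → ({a, b} : Set V) ≠ {u, v} →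
      ({a, b} : Set V) ≠ {v, w} → ({a, b} : Set V) ≠ {w, u} →
      G'.len a b = G.len a b) :
    ∀ a ∈ K, ∀ b ∈ K, graphDist G' a b = graphDist G a b := by
  have hux : G.Adj x u := (hnb u).2 (by simp)
  have hvx : G.Adj x v := (hnb v).2 (by simp)
  have hwx : G.Adj x w := (hnb w).2 (by simp)
  simp only [ne_eq, set_pair_eq] at hAdj hlold
  have hluv' := G'.len_symm u v
  have hlvw' := G'.len_symm v w
  have hlwu' := G'.len_symm w u
  have hsu := G.len_symm x u
  have hsv := G.len_symm x v
  have hsw := G.len_symm x w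
  -- edges of the triangle
  have tri : ∀ c d, G.Adj x c → G.Adj x d → c ≠ d →
      G'.Adj c d ∧ G'.len c d = G.len c x + G.len x d := by
    intro c d hc hd hcd
    rw [hnb] at hc hd
    refine ⟨?_, ?_⟩
    · rw [hAdj]
      grind
    · rcases hc with rfl | rfl | rfl <;> rcases hd with rfl | rfl | rfl <;>
        first | exact absurd rfl hcd | linarith
  have old : ∀ c d, G.Adj c d → c ≠ x → d ≠ x → G'.Adj c d ∧ G'.len c d = G.len c d := by
    intro c d h hc hd
    refine ⟨(hAdj c d).2 (Or.inl ⟨h, hc, hd⟩), hlold c d hc hd ?_ ?_ ?_⟩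
    · rintro (⟨rfl, rfl⟩ | ⟨rfl, rfl⟩)
      exacts [huvAdj h, huvAdj (G.symm _ _ h)]
    · rintro (⟨rfl, rfl⟩ | ⟨rfl, rfl⟩)
      exacts [hvwAdj h, hvwAdj (G.symm _ _ h)]
    · rintro (⟨rfl, rfl⟩ | ⟨rfl, rfl⟩)
      exacts [huwAdj (G.symm _ _ h), huwAdj h]
  have new : ∀ c d, G'.Adj c d → (G.Adj c d ∧ c ≠ x ∧ d ≠ x) ∨
      (G.Adj x c ∧ G.Adj x d ∧ c ≠ d) := by
    intro c d h
    rcases (hAdj c d).1 h with h | h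
    · exact Or.inl h
    · right
      rcases h with (⟨rfl, rfl⟩ | ⟨rfl, rfl⟩) | (⟨rfl, rfl⟩ | ⟨rfl, rfl⟩) |
        (⟨rfl, rfl⟩ | ⟨rfl, rfl⟩) <;>
      exact ⟨by assumption, by assumption, by first | assumption | (apply Ne.symm; assumption)⟩
  intro a ha b hb
  have hax : a ≠ x := fun h => hxK (h ▸ ha)
  have hbx : b ≠ x := fun h => hxK (h ▸ hb)
  apply le_antisymm
  · apply graphDist_le_of_WD
    have key : ∀ s r, WD G b s r → (s ≠ x → ∃ r', r' ≤ r ∧ WD G' b s r') ∧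
        (s = x → ∃ c r', G.Adj x c ∧ G.len x c + r' ≤ r ∧ WD G' b c r') := by
      intro s r h
      induction h with
      | nil => exact ⟨fun _ => ⟨0, le_rfl, WD.nil⟩, fun h => absurd h hbx⟩
      | cons s c r hadj _ ih =>
        refine ⟨fun hs => ?_, fun hs => ?_⟩
        · by_cases hc : c = x
          · obtain ⟨d, r', hd, hle, hw⟩ := ih.2 hc
            subst hc
            by_cases hsd : s = d
            · subst hsd
              have h1 := G.len_nonneg s c
              have h2 := G.len_nonneg c s
              exact ⟨r', by linarith, hw⟩
            · obtain ⟨h1, h2⟩ := tri s d (G.symm _ _ hadj) hd hsd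
              exact ⟨_, by rw [h2]; linarith, WD.cons _ _ _ h1 hw⟩
          · obtain ⟨r', hle, hw⟩ := ih.1 hc
            obtain ⟨h1, h2⟩ := old s c hadj hs hc
            exact ⟨_, by rw [h2]; linarith, WD.cons _ _ _ h1 hw⟩
        · subst hs
          have hc : c ≠ s := fun h => G.irrefl s (h ▸ hadj)
          obtain ⟨r', hle, hw⟩ := ih.1 hc
          exact ⟨c, r', hadj, by linarith, hw⟩
    exact fun r h => (key a r h).1 hax
  · apply graphDist_le_of_WD
    intro r h
    clear ha hax
    induction h with
    | nil => exact ⟨0, le_rfl, WD.nil⟩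
    | cons s c r hadj _ ih =>
      obtain ⟨r', hle, hw⟩ := ih
      rcases new s c hadj with ⟨h, hs, hc⟩ | ⟨hs, hc, hsc⟩
      · have h2 := (old s c h hs hc).2
        exact ⟨_, by rw [h2]; linarith, WD.cons _ _ _ h hw⟩
      · have h2 := (tri s c hs hc hsc).2
        exact ⟨_, by rw [h2, add_assoc]; linarith,
          WD.cons _ _ _ (G.symm _ _ hs) (WD.cons _ _ _ hc hw)⟩
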